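/- Let κ be a type and E a finite subset of ℕ. Let p be a finite partial function from ℕ × ℕ to Bool, and let q, q' be finite partial functions from ℕ to κ such that E ⊆ dom(q) ∩ dom(q') and q(n) = q'(n) for all n ∈ E. Then there exists a finitary permutation π of ℕ fixing E pointwise such that the finite partial function p^π with domain {(π n, k) : (n, k) ∈ dom(p)} defined by p^π(π n, k) = p(n, k) is compatible with p, and the finite partial function q^π with domain π '' dom(q) defined by q^π(π n) = q(n) is compatible with q'. -/

import Mathlib

/-- Two partial (`Option`-valued) functions are *compatible* if they agree
wherever both are defined. -/
def Compatible {α β : Type*} (p q : α → Option β) : Prop :=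
  ∀ x, p x ≠ none → q x ≠ none → p x = q x

/-- The combinatorial core of upwards homogeneity of the collapse `Col(A, κ)`
over Cohen's first model: given a finite `E ⊆ ℕ`, a finite partial function
`p : ℕ × ℕ ⇀ Bool`, and finite partial functions `q q' : ℕ ⇀ κ` with
`E ⊆ dom q ∩ dom q'` on which `q` and `q'` agree, there is a finitary
permutation `π ∈ fix(E)` such that `p^π` (defined by `p^π (π n, k) = p (n, k)`)
is compatible with `p` and `q^π` (defined by `q^π (π n) = q n`) is compatible
with `q'`. -/
theorem collapse_upwards_homogeneity_core {κ : Type*} (E : Finset ℕ)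
    (p : ℕ × ℕ → Option Bool) (hp : {x | p x ≠ none}.Finite)
    (q q' : ℕ → Option κ)
    (hq : {n | q n ≠ none}.Finite) (hq' : {n | q' n ≠ none}.Finite)
    (hdom : ∀ n ∈ E, q n ≠ none ∧ q' n ≠ none)
    (hagree : ∀ n ∈ E, q n = q' n) :
    ∃ π : Equiv.Perm ℕ,
      {n | π n ≠ n}.Finite ∧ (∀ n ∈ E, π n = n) ∧
      Compatible (fun x : ℕ × ℕ => p (π.symm x.1, x.2)) p ∧
      Compatible (fun n : ℕ => q (π.symm n)) q' := by
  obtain ⟨N1, h1⟩ := (hp.image Prod.fst).bddAbove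
  obtain ⟨N2, h2⟩ := hq.bddAbove
  obtain ⟨N3, h3⟩ := hq'.bddAbove
  obtain ⟨N, hN1, hN2, hN3⟩ : ∃ N, N1 < N ∧ N2 < N ∧ N3 < N :=
    ⟨N1 + N2 + N3 + 1, by omega, by omega, by omega⟩
  have hpN : ∀ n k, p (n, k) ≠ none → n < N := fun n k h =>
    lt_of_le_of_lt (h1 ⟨(n, k), h, rfl⟩) hN1
  have hqN : ∀ n, q n ≠ none → n < N := fun n h => lt_of_le_of_lt (h2 h) hN2
  have hqN' : ∀ n, q' n ≠ none → n < N := fun n h => lt_of_le_of_lt (h3 h) hN3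
  have hEN : ∀ n ∈ E, n < N := fun n h => hqN n (hdom n h).1
  let f : ℕ → ℕ := fun n =>
    if n < N then (if n ∈ E then n else n + N)
    else if n < N + N ∧ n - N ∉ E then n - N else n
  have hf : Function.Involutive f := by
    intro n
    by_cases hn : n < N
    · by_cases hE : n ∈ E
      · simp [f, hn, hE]
      · simp [f, hn, hE]
    · by_cases hE : n < N + N ∧ n - N ∉ E
      · have h4 : n - N < N := by omega
        have h5 : n - N + N = n := by omega
        simp only [f, hn, hE, h4, h5, if_true, if_false, not_false_eq_true, and_self]
      · simp only [f, hn, hE, if_false]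
  have hfE : ∀ n ∈ E, f n = n := fun n h => by simp [f, hEN n h, h]
  have hfN : ∀ n, n < N → f n < N → n ∈ E := by
    intro n hn h
    by_contra hE
    simp [f, hn, hE] at h
  refine ⟨hf.toPerm, ?_, hfE, ?_, ?_⟩
  · refine (Set.finite_lt_nat (N + N)).subset ?_
    intro n hn
    by_contra h
    have h' : ¬ n < N + N := h
    have h6 : ¬ n < N := by omega
    exact hn (show f n = n by simp [f, h', h6])
  · rintro ⟨n, k⟩ ha hb
    change p (f n, k) ≠ none at ha
    change p (f n, k) = p (n, k)
    rw [hfE n (hfN n (hpN _ _ hb) (hpN _ _ ha))]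
  · intro n ha hb
    change q (f n) ≠ none at ha
    change q (f n) = q' n
    have hE := hfN n (hqN' _ hb) (hqN _ ha)
    rw [hfE n hE, hagree n hE]
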